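/- Let K be a field and let G be a multi-path graph all of whose path lengths are at least 2, consisting of m paths of even length and n paths of odd length, with m + n ≥ 2. Then the projective dimension of the edge ring K[G] as a module over the polynomial ring K[E(G)] equals m + n − 2 if both m ≥ 1 and n ≥ 1, and equals m + n − 1 otherwise. -/

import Mathlib

open CategoryTheory MvPolynomial Finset
open scoped Classical

noncomputable section

namespace Paper

/-- The monomial `x_u * x_v` associated to an unordered pair `{u, v}` of vertices. -/
def edgeMon (K : Type*) [CommRing K] {V : Type*} (e : Sym2 V) : MvPolynomial V K :=
  Sym2.lift ⟨fun u v => X u * X v, fun u v => mul_comm _ _⟩ e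

/-- The `K`-algebra map `K[E(G)] → K[V(G)]` sending the variable of an edge `{u,v}` to
`x_u * x_v`. -/
def edgeHom (K : Type*) [CommRing K] {V : Type*} (G : SimpleGraph V) :
    MvPolynomial G.edgeSet K →ₐ[K] MvPolynomial V K :=
  aeval (fun e => edgeMon K (e : Sym2 V))

/-- The toric ideal of a simple graph. -/
def toricIdeal (K : Type*) [CommRing K] {V : Type*} (G : SimpleGraph V) :
    Ideal (MvPolynomial G.edgeSet K) :=
  RingHom.ker (edgeHom K G).toRingHom

/-- The edge ring `K[G] = K[E(G)]/I_G`. -/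
abbrev edgeRing (K : Type*) [CommRing K] {V : Type*} (G : SimpleGraph V) :=
  MvPolynomial G.edgeSet K ⧸ toricIdeal K G

open CategoryTheory.Limits in
/-- The projective dimension of a module, as an element of `ℕ∞`:  the least `n` such that `M`
admits a projective resolution vanishing in homological degrees `> n` (or `⊤` if there is
no such finite resolution). -/
def projDim (R : Type*) [CommRing R] (M : ModuleCat R) : ℕ∞ :=
  sInf {n : ℕ∞ | ∃ m : ℕ, (m : ℕ∞) = n ∧
    ∃ P : ProjectiveResolution M, ∀ i : ℕ, m < i → IsZero (P.complex.X i)}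

/-- The 0-1 vector `ε_u + ε_v` attached to an unordered pair `{u,v}` with `u ≠ v`. -/
def edgeVec {V : Type*} (e : Sym2 V) : V → ℝ :=
  fun v => if v ∈ e then 1 else 0

/-- The edge cone of a finite simple graph: all nonnegative real combinations of the vectors
`v_e = ε_u + ε_v`, for `e = {u,v}` an edge of `G`. -/
def edgeCone {V : Type*} [Fintype V] (G : SimpleGraph V) : Set (V → ℝ) :=
  {x | ∃ a : Sym2 V → ℝ, (∀ e, 0 ≤ a e) ∧ (∀ e, e ∉ G.edgeSet → a e = 0) ∧
    x = ∑ e : Sym2 V, a e • edgeVec e}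

/-- A vector has integer coordinates. -/
def IsIntegralVec {V : Type*} (x : V → ℝ) : Prop := ∀ v, ∃ n : ℤ, x v = n

/-- A minimal vector of `relint(ℝ₊(G)) ∩ ℤ^{V(G)}`. -/
def IsMinimalVec {V : Type*} [Fintype V] (G : SimpleGraph V) (x : V → ℝ) : Prop :=
  x ∈ intrinsicInterior ℝ (edgeCone G) ∧ IsIntegralVec x ∧
    ¬ ∃ y z : V → ℝ, (y ∈ intrinsicInterior ℝ (edgeCone G) ∧ IsIntegralVec y) ∧
      (z ∈ edgeCone G ∧ IsIntegralVec z ∧ z ≠ 0) ∧ x = y + z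

/-! ### Multi-path graphs.  `c i` is the number of interior vertices of the `i`-th path,
so the `i`-th path has length `c i + 1`. -/

/-- Vertices of the multi-path graph: `Sum.inl 0 = v1`, `Sum.inl 1 = v2`, and
`Sum.inr ⟨i, j⟩ = u_{i,j+1}`, the `(j+1)`-st interior vertex of the `i`-th path. -/
abbrev MPV {m : ℕ} (c : Fin m → ℕ) : Type := Fin 2 ⊕ (Σ i : Fin m, Fin (c i))

def mpRel {m : ℕ} (c : Fin m → ℕ) : MPV c → MPV c → Prop
  | Sum.inl a, Sum.inr ⟨i, j⟩ => (a = 0 ∧ (j : ℕ) = 0) ∨ (a = 1 ∧ (j : ℕ) + 1 = c i)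
  | Sum.inr ⟨i, j⟩, Sum.inr ⟨i', j'⟩ => (i : ℕ) = i' ∧ (j' : ℕ) = (j : ℕ) + 1
  | _, _ => False

/-- The multi-path graph with `m` paths, the `i`-th of which has `c i` interior vertices
(hence length `c i + 1`), all starting at `v1 = Sum.inl 0` and ending at `v2 = Sum.inl 1`. -/
def multiPath {m : ℕ} (c : Fin m → ℕ) : SimpleGraph (MPV c) :=
  SimpleGraph.fromRel (mpRel c)

/-! ### The two-ear graph `G_m` and the one-ear graph `P_m`. -/

/-- Vertices of the two-ear graph:  `Sum.inl 0 = v1`, `Sum.inl 1 = v2`, `Sum.inl 2 = x1`,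
`Sum.inl 3 = x2`, `Sum.inl 4 = y1`, `Sum.inl 5 = y2`, and `Sum.inr i = u_{i+1}`. -/
abbrev TEV (m : ℕ) : Type := Fin 6 ⊕ Fin (m - 1)

def teRel (m : ℕ) : TEV m → TEV m → Prop
  | Sum.inl a, Sum.inl b =>
      (a = 0 ∧ b = 2) ∨ (a = 0 ∧ b = 3) ∨ (a = 2 ∧ b = 3) ∨ (a = 1 ∧ b = 4) ∨
      (a = 1 ∧ b = 5) ∨ (a = 4 ∧ b = 5) ∨ (a = 2 ∧ b = 4)
  | Sum.inl a, Sum.inr _ => a = 0 ∨ a = 1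
  | _, _ => False

/-- The two-ear graph `𝐆_m`. -/
def twoEar (m : ℕ) : SimpleGraph (TEV m) := SimpleGraph.fromRel (teRel m)

/-- The one-ear graph `𝐏_m`, the induced subgraph of `𝐆_m` on the complement of `x2`. -/
def oneEar (m : ℕ) : SimpleGraph ({v : TEV m | v ≠ Sum.inl 3} : Set (TEV m)) :=
  (twoEar m).induce {v : TEV m | v ≠ Sum.inl 3}

/-! ### Cycles, the odd-cycle condition, and compact graphs. -/

/-- The odd-cycle condition: any two vertex-disjoint odd cycles are joined by an edge. -/
def OddCycleCondition {V : Type*} (G : SimpleGraph V) : Prop :=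
  ∀ (a b : V) (c₁ : G.Walk a a) (c₂ : G.Walk b b), c₁.IsCycle → c₂.IsCycle →
    Odd c₁.length → Odd c₂.length →
    (∀ x, x ∈ c₁.support → x ∉ c₂.support) →
    ∃ x ∈ c₁.support, ∃ y ∈ c₂.support, G.Adj x y

/-- `G` has no even cycle. -/
def HasNoEvenCycle {V : Type*} (G : SimpleGraph V) : Prop :=
  ∀ (a : V) (c : G.Walk a a), c.IsCycle → ¬ Even c.length

/-- A compact graph: connected, all degrees at least `2`, no even cycle, and the
odd-cycle condition holds. -/
def IsCompactGraph {V : Type*} (G : SimpleGraph V) : Prop :=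
  G.Connected ∧ (∀ v : V, 2 ≤ (G.neighborSet v).ncard) ∧ HasNoEvenCycle G ∧ OddCycleCondition G

/-- The number `t(G)` of minimal (= induced) cycles of `G`, counted via their vertex sets. -/
def cycleCount {V : Type*} (G : SimpleGraph V) : ℕ :=
  Set.ncard {S : Set V | ∃ (a : V) (c : G.Walk a a), c.IsCycle ∧
    (∀ x y, x ∈ c.support → y ∈ c.support → G.Adj x y → s(x, y) ∈ c.edges) ∧
    S = {x | x ∈ c.support}}


set_option linter.style.haveILetI false

section Homological

open CategoryTheory.Limits CategoryTheory.Abelian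

universe v u

variable {C : Type u} [Category.{v} C] [Abelian C]

/-- Splicing a projective resolution of the first term of a short exact sequence with projective
middle term. -/
def spliceRes (S : ShortComplex C) (hS : S.ShortExact) (hP : Projective S.X₂)
    (Q : ProjectiveResolution S.X₁) (p : Q.complex.X 0 ⟶ S.X₁) (hp : Epi p)
    (w : Q.complex.d 1 0 ≫ p = 0) (h0 : (ShortComplex.mk (Q.complex.d 1 0) p w).Exact) :
    ProjectiveResolution S.X₃ :=
  haveI := hS.mono_f
  haveI := hS.epi_g
  { complex := ChainComplex.augment Q.complex (p ≫ S.f) (by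
      rw [← Category.assoc, w, zero_comp])
    projective := fun n => by
      cases n
      · exact hP
      · exact Q.projective _
    π := (ChainComplex.toSingle₀Equiv _ _).symm ⟨S.g, by
      have : p ≫ S.f ≫ S.g = 0 := by rw [S.zero, comp_zero]
      exact (Category.assoc _ _ _).trans this⟩
    quasiIso := ⟨fun n => by
      rcases n with _ | _ | n
      · rw [ChainComplex.quasiIsoAt₀_iff, ShortComplex.quasiIso_iff_of_zeros']
        · have h1 : (ShortComplex.mk (p ≫ S.f) S.g
              (by rw [Category.assoc, S.zero, comp_zero])).Exact := by
            let α : ShortComplex.mk (p ≫ S.f) S.g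
              (by rw [Category.assoc, S.zero, comp_zero]) ⟶ S :=
              { τ₁ := p
                τ₂ := 𝟙 _
                τ₃ := 𝟙 _ 
                comm₁₂ := (Category.comp_id _).symm
                comm₂₃ := by simp }
            haveI : Epi α.τ₁ := inferInstanceAs (Epi (p))
            haveI : IsIso α.τ₂ := inferInstanceAs (IsIso (𝟙 _))
            haveI : Mono α.τ₃ := inferInstanceAs (Mono (𝟙 _))
            rw [ShortComplex.exact_iff_of_epi_of_isIso_of_mono α]
            exact hS.exact
          refine (ShortComplex.exact_and_epi_g_iff_of_iso ?_).2 ⟨h1, hS.epi_g⟩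
          refine ShortComplex.isoMk (Iso.refl _) (Iso.refl _) (Iso.refl _) ?_ ?_
          · exact (Category.id_comp _).trans (Category.comp_id _).symm
          · refine (Category.id_comp _).trans (Eq.trans ?_ (Category.comp_id _).symm)
            symm
            exact ChainComplex.toSingle₀Equiv_symm_apply_f_zero _ _
        all_goals rfl
      · rw [quasiIsoAt_iff_exactAt']
        · rw [HomologicalComplex.exactAt_iff' _ 2 1 0 (by simp) (by simp)]
          have h1 : (ShortComplex.mk (Q.complex.d 1 0) (p ≫ S.f)
              (by rw [← Category.assoc, w, zero_comp])).Exact := by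
            let α : ShortComplex.mk (Q.complex.d 1 0) (p) w ⟶
               ShortComplex.mk (Q.complex.d 1 0) (p ≫ S.f)
              (by rw [← Category.assoc, w, zero_comp]) :=
              { τ₁ := 𝟙 _
                τ₂ := 𝟙 _
                τ₃ := S.f
                comm₁₂ := by simp
                comm₂₃ := Category.id_comp _ }
            haveI : Epi α.τ₁ := inferInstanceAs (Epi (𝟙 _))
            haveI : IsIso α.τ₂ := inferInstanceAs (IsIso (𝟙 _))
            haveI : Mono α.τ₃ := inferInstanceAs (Mono S.f)
            rw [← ShortComplex.exact_iff_of_epi_of_isIso_of_mono α]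
            exact h0
          exact h1
        · apply ChainComplex.exactAt_succ_single_obj
      · rw [quasiIsoAt_iff_exactAt']
        · rw [HomologicalComplex.exactAt_iff' _ (n+3) (n+2) (n+1) (by simp) (by simp)]
          exact Q.exact_succ n
        · apply ChainComplex.exactAt_succ_single_obj⟩ }

lemma exists_res [EnoughProjectives C] (n : ℕ) (M : C) (h : HasProjectiveDimensionLT M (n + 1)) :
    ∃ P : ProjectiveResolution M, ∀ i : ℕ, n < i → IsZero (P.complex.X i) := by
  induction n generalizing M with
  | zero =>
    haveI : Projective M := projective_iff_hasProjectiveDimensionLT_one.2 h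
    refine ⟨ProjectiveResolution.self M, fun i hi => ?_⟩
    apply HomologicalComplex.isZero_single_obj_X
    omega
  | succ n ih =>
    let S : ShortComplex C := ShortComplex.mk (kernel.ι (Projective.π M)) (Projective.π M)
      (kernel.condition _)
    have hS : S.ShortExact :=
      { exact := ShortComplex.exact_of_f_is_kernel _ (kernelIsKernel _)
        mono_f := inferInstanceAs (Mono (kernel.ι _))
        epi_g := inferInstanceAs (Epi (Projective.π M)) }
    have hP : Projective S.X₂ := inferInstanceAs (Projective (Projective.over M))
    have h1 : HasProjectiveDimensionLT S.X₁ (n + 1) :=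
      (hS.hasProjectiveDimensionLT_X₃_iff n hP).1 h
    obtain ⟨Q, hQ⟩ := ih S.X₁ h1
    refine ⟨spliceRes S hS hP Q (Q.π.f 0) (inferInstanceAs (Epi (Q.π.f 0))) Q.complex_d_comp_π_f_zero
      (ShortComplex.exact_of_g_is_cokernel _ Q.isColimitCokernelCofork), fun i hi => ?_⟩
    obtain ⟨j, rfl⟩ : ∃ j, i = j + 1 := ⟨i - 1, by omega⟩
    exact hQ j (by omega)

end Homological

section HProp
open CategoryTheory.Limits CategoryTheory.Abelian
universe u

variable {R : Type u} [CommRing R]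

/-- `M` has projective dimension exactly `r`, detected by `Ext^r(M, k)`. -/
def HProp (k M : ModuleCat.{u} R) (r : ℕ) : Prop :=
  HasProjectiveDimensionLT M (r + 1) ∧ Nontrivial (Ext M k r)

lemma projDim_eq (k M : ModuleCat.{u} R) (r : ℕ) (h : HProp k M r) : projDim R M = r := by
  apply le_antisymm
  · obtain ⟨P, hP⟩ := exists_res r M h.1
    exact sInf_le ⟨r, rfl, P, hP⟩
  · apply le_sInf
    rintro _ ⟨m, rfl, P, hP⟩
    by_contra hlt
    have hlt' : m < r := by exact_mod_cast not_le.1 hlt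
    obtain ⟨α, hα⟩ := @exists_ne _ h.2 (0 : Ext M k r)
    obtain ⟨f, hf, rfl⟩ := P.extMk_surjective α (r + 1) rfl
    obtain rfl : f = 0 := (hP r hlt').eq_of_src _ _
    exact hα (P.extMk_zero _ _)

lemma HProp.of_iso {k M M' : ModuleCat.{u} R} {r : ℕ} (e : M ≅ M') (h : HProp k M r) :
    HProp k M' r := by
  haveI := h.1
  refine ⟨hasProjectiveDimensionLT_of_iso e _, ?_⟩
  obtain ⟨α, hα⟩ := @exists_ne _ h.2 (0 : Ext M k r)
  refine ⟨(Ext.mk₀ e.inv).comp α (zero_add r), 0, fun h0 => hα ?_⟩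
  have := congrArg (fun z => (Ext.mk₀ e.hom).comp z (zero_add r)) h0
  simpa using this

lemma precomp_eq_zero {k X Y : ModuleCat.{u} R} {r : ℕ} (a b : R) (ha : a • 𝟙 k = 0)
    (hb : b • 𝟙 k = 0) (f g : X ⟶ Y) (α : Ext Y k r) :
    (Ext.mk₀ (b • f - a • g)).comp α (zero_add r) = 0 := by
  have key : ∀ (c : R) (hc : c • 𝟙 k = 0) (β : Ext X k r), c • β = 0 := by
    intro c hc β
    rw [Ext.smul_eq_comp_mk₀, hc, Ext.mk₀_zero, Ext.comp_zero]
  rw [sub_eq_add_neg, Ext.mk₀_add, Ext.mk₀_neg, Ext.add_comp, Ext.neg_comp, Ext.mk₀_smul,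
    Ext.mk₀_smul, Ext.smul_comp, Ext.smul_comp, key b hb, key a ha]
  simp

/-- main homological step -/
lemma HProp.step {k P M C₁ C₂ : ModuleCat.{u} R} {r : ℕ} (f : P ⟶ M) (g₁ : M ⟶ C₁)
    (ψ : P ⟶ M) (g₂ : M ⟶ C₂) (a b : R) (ha : a • 𝟙 k = 0) (hb : b • 𝟙 k = 0)
    (w₁ : f ≫ g₁ = 0) (h₁ : (ShortComplex.mk f g₁ w₁).ShortExact)
    (w₂ : (b • f - a • ψ) ≫ g₂ = 0)
    (h₂ : (ShortComplex.mk (b • f - a • ψ) g₂ w₂).ShortExact)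
    (hM : HasProjectiveDimensionLT M (r + 1)) (hC : HProp k C₁ (r + 1)) :
    HProp k C₂ (r + 1) := by
  have hP : HasProjectiveDimensionLT P (r + 1) :=
    h₁.hasProjectiveDimensionLT_X₁ (r + 1) hM hC.1
  refine ⟨h₂.hasProjectiveDimensionLT_X₃ (r + 1) hP
    (hasProjectiveDimensionLT_of_ge M (r+1) (r + 1 + 1) (by omega)), ?_⟩
  obtain ⟨α, hα⟩ := @exists_ne _ hC.2 (0 : Ext C₁ k (r + 1))
  obtain ⟨β, hβ⟩ := Ext.contravariant_sequence_exact₃ h₁ k α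
    (Ext.eq_zero_of_hasProjectiveDimensionLT _ (r + 1) le_rfl) (n₀ := r) (by omega)
  refine ⟨h₂.extClass.comp β (by omega), 0, fun h0 => hα ?_⟩
  obtain ⟨γ, hγ⟩ := Ext.contravariant_sequence_exact₁ h₂ k β (by omega) h0
  have h3 : β = 0 := hγ.symm.trans (precomp_eq_zero a b ha hb f ψ γ)
  rw [← hβ, h3, Ext.comp_zero]

/-- killing a nonzerodivisor -/
lemma HProp.reg {k M C : ModuleCat.{u} R} {r : ℕ} (g : M ⟶ C)
    (b : R) (hb : b • 𝟙 k = 0)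
    (w : (b • 𝟙 M) ≫ g = 0) (h : (ShortComplex.mk (b • 𝟙 M) g w).ShortExact)
    (hM : HProp k M r) :
    HProp k C (r + 1) := by
  refine ⟨h.hasProjectiveDimensionLT_X₃ (r + 1) hM.1
    (@hasProjectiveDimensionLT_of_ge _ _ _ M (r+1) (r + 1 + 1) (by omega) hM.1), ?_⟩
  obtain ⟨β, hα⟩ := @exists_ne _ hM.2 (0 : Ext M k r)
  refine ⟨h.extClass.comp β (by omega), 0, fun h0 => hα ?_⟩
  obtain ⟨γ, hγ⟩ := Ext.contravariant_sequence_exact₁ h k β (by omega) h0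
  have h3 := precomp_eq_zero (r := r) 0 b (by simp) hb (𝟙 M) (𝟙 M) γ
  rw [zero_smul, sub_zero] at h3
  exact hγ.symm.trans h3

end HProp

section Ideals
universe u
variable {R : Type u} [CommRing R]

lemma shortExact_of {A B D : Type u} [AddCommGroup A] [AddCommGroup B] [AddCommGroup D]
    [Module R A] [Module R B] [Module R D] (f : ModuleCat.of R A ⟶ ModuleCat.of R B)
    (g : ModuleCat.of R B ⟶ ModuleCat.of R D)
    (w : f ≫ g = 0) (hf : Function.Injective f.hom) (hg : Function.Surjective g.hom)
    (h : LinearMap.range f.hom = LinearMap.ker g.hom) :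
    (ShortComplex.mk f g w).ShortExact :=
  { exact := (ShortComplex.moduleCat_exact_iff_range_eq_ker _).2 h
    mono_f := (ModuleCat.mono_iff_injective f).2 hf
    epi_g := (ModuleCat.epi_iff_surjective g).2 hg }

/-- the quotient map between quotients by nested ideals -/
def quotMap (I I' : Ideal R) (h : I ≤ I') : (R ⧸ I) →ₗ[R] (R ⧸ I') :=
  Submodule.liftQ I (Submodule.mkQ I') (by rwa [Submodule.ker_mkQ])

lemma quotMap_surj (I I' : Ideal R) (h : I ≤ I') : Function.Surjective (quotMap I I' h) := by
  intro y
  obtain ⟨x, rfl⟩ := Submodule.mkQ_surjective _ y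
  exact ⟨Submodule.mkQ I x, rfl⟩

lemma quotMap_ker (I : Ideal R) (s : Set R) :
    LinearMap.ker (quotMap I (I ⊔ Ideal.span s) le_sup_left) =
      Submodule.span R (Submodule.mkQ I '' s) := by
  unfold quotMap
  rw [Submodule.ker_liftQ, Submodule.ker_mkQ, Submodule.map_sup, ← Submodule.map_span]
  have : Submodule.map (Submodule.mkQ I) I = ⊥ := by
    rw [← le_bot_iff, Submodule.map_le_iff_le_comap]
    intro x hx
    simpa using hx
  rw [this, bot_sup_eq]

/-- `R/I` has projective dimension exactly `r`, detected by `k`. -/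
def HI (k : ModuleCat.{u} R) (I : Ideal R) (r : ℕ) : Prop :=
  HProp k (ModuleCat.of R (R ⧸ I)) r

/-- `b` is a nonzerodivisor modulo `I` -/
def NZ (I : Ideal R) (b : R) : Prop := ∀ x, b * x ∈ I → x ∈ I

lemma NZ.inj {I : Ideal R} {b : R} (h : NZ I b) (x y : R ⧸ I) (hxy : b • x = b • y) : x = y := by
  rw [← sub_eq_zero] at hxy ⊢
  rw [← smul_sub] at hxy
  obtain ⟨z, hz⟩ := Submodule.mkQ_surjective _ (x - y)
  rw [← hz] at hxy ⊢
  rw [← map_smul, Submodule.mkQ_apply, Submodule.Quotient.mk_eq_zero] at hxy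
  rw [Submodule.mkQ_apply, Submodule.Quotient.mk_eq_zero]
  exact h z hxy

lemma HI.reg {k : ModuleCat.{u} R} {I : Ideal R} {r : ℕ} (b : R) (hb : b • 𝟙 k = 0)
    (hn : NZ I b) (h : HI k I r) : HI k (I ⊔ Ideal.span {b}) (r + 1) := by
  have hr : LinearMap.range (b • 𝟙 (ModuleCat.of R (R ⧸ I))).hom =
      LinearMap.ker (quotMap I (I ⊔ Ideal.span {b}) le_sup_left) := by
    rw [quotMap_ker, Set.image_singleton]
    ext x
    rw [Submodule.mem_span_singleton, LinearMap.mem_range]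
    constructor
    · rintro ⟨y, rfl⟩
      obtain ⟨z, rfl⟩ := Submodule.mkQ_surjective _ y
      refine ⟨z, ?_⟩
      change z • Submodule.mkQ I b = b • Submodule.mkQ I z
      rw [← map_smul, ← map_smul, smul_eq_mul, smul_eq_mul, mul_comm]
    · rintro ⟨z, rfl⟩
      refine ⟨Submodule.mkQ I z, ?_⟩
      change b • Submodule.mkQ I z = z • Submodule.mkQ I b
      rw [← map_smul, ← map_smul, smul_eq_mul, smul_eq_mul, mul_comm]
  have w : (b • 𝟙 (ModuleCat.of R (R ⧸ I))) ≫
      ModuleCat.ofHom (quotMap I (I ⊔ Ideal.span {b}) le_sup_left) = 0 := by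
    ext1
    refine LinearMap.ext fun x => ?_
    have : (b • 𝟙 (ModuleCat.of R (R ⧸ I))).hom x ∈
      LinearMap.ker (quotMap I (I ⊔ Ideal.span {b}) le_sup_left) := hr ▸ ⟨x, rfl⟩
    exact this
  refine HProp.reg _ b hb w (shortExact_of _ _ w ?_ (quotMap_surj _ _ le_sup_left) hr) h
  intro x y hxy
  exact hn.inj x y hxy

lemma HI.step {k : ModuleCat.{u} R} {I : Ideal R} {r : ℕ} {ι : Type*} (s : Set ι) (a b : ι → R)
    (i₀ : ι) (α β : R) (hα : α • 𝟙 k = 0) (hβ : β • 𝟙 k = 0)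
    (hmin : ∀ i ∈ s, a i₀ * b i - a i * b i₀ ∈ I) (hn : NZ I (a i₀))
    (hg : NZ I (a i₀ * β - α * b i₀))
    (h : HI k I r) (h' : HI k (I ⊔ Ideal.span (a '' s)) (r + 1)) :
    HI k (I ⊔ Ideal.span ((fun i => a i * β - α * b i) '' s)) (r + 1) := by
  set P : Submodule R (R ⧸ I) := Submodule.span R (Submodule.mkQ I '' (a '' s)) with hP
  have hPle : ∀ p : P, b i₀ • (p : R ⧸ I) ∈
      LinearMap.range (LinearMap.lsmul R (R ⧸ I) (a i₀)) := by
    have : P ≤ (LinearMap.range (LinearMap.lsmul R (R ⧸ I) (a i₀))).comap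
        (LinearMap.lsmul R (R ⧸ I) (b i₀)) := by
      rw [hP, Submodule.span_le]
      rintro _ ⟨_, ⟨i, hi, rfl⟩, rfl⟩
      refine ⟨Submodule.mkQ I (b i), ?_⟩
      change a i₀ • Submodule.mkQ I (b i) = b i₀ • Submodule.mkQ I (a i)
      rw [← map_smul, ← map_smul, ← sub_eq_zero, ← map_sub, Submodule.mkQ_apply,
        Submodule.Quotient.mk_eq_zero, smul_eq_mul, smul_eq_mul, mul_comm (b i₀)]
      exact hmin i hi
    exact fun p => this p.2
  have hinj : Function.Injective (LinearMap.lsmul R (R ⧸ I) (a i₀)) := fun x y hxy => hn.inj x y hxy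
  let ψ : P →ₗ[R] (R ⧸ I) := (LinearEquiv.ofInjective _ hinj).symm.toLinearMap ∘ₗ
    LinearMap.codRestrict _ (LinearMap.lsmul R (R ⧸ I) (b i₀) ∘ₗ P.subtype) hPle
  have hψ : ∀ p : P, a i₀ • ψ p = b i₀ • (p : R ⧸ I) := by
    intro p
    have := LinearEquiv.apply_symm_apply (LinearEquiv.ofInjective _ hinj)
      (LinearMap.codRestrict _ (LinearMap.lsmul R (R ⧸ I) (b i₀) ∘ₗ P.subtype) hPle p)
    exact congrArg Subtype.val this
  let F : ModuleCat.of R P ⟶ ModuleCat.of R (R ⧸ I) := ModuleCat.ofHom P.subtype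
  let Ψ : ModuleCat.of R P ⟶ ModuleCat.of R (R ⧸ I) := ModuleCat.ofHom ψ
  have hθ : ∀ p : P, (β • F - α • Ψ).hom p = β • (p : R ⧸ I) - α • ψ p := fun p => rfl
  have hθ' : ∀ p : P, a i₀ • (β • F - α • Ψ).hom p =
      (a i₀ * β - α * b i₀) • (p : R ⧸ I) := by
    intro p
    rw [hθ, smul_sub, smul_comm (a i₀) α, hψ, sub_smul, mul_smul, mul_smul]
  have hr1 : LinearMap.range F.hom =
      LinearMap.ker (quotMap I (I ⊔ Ideal.span (a '' s)) le_sup_left) := by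
    rw [quotMap_ker]
    exact Submodule.range_subtype P
  have w1 : F ≫ ModuleCat.ofHom (quotMap I (I ⊔ Ideal.span (a '' s)) le_sup_left) = 0 := by
    ext1
    refine LinearMap.ext fun x => ?_
    have : F.hom x ∈ LinearMap.ker (quotMap I (I ⊔ Ideal.span (a '' s)) le_sup_left) :=
      hr1 ▸ ⟨x, rfl⟩
    exact this
  have hgen : ∀ (i : ι) (hi : i ∈ s) (hm : Submodule.mkQ I (a i) ∈ P),
      (β • F - α • Ψ).hom ⟨Submodule.mkQ I (a i), hm⟩ = Submodule.mkQ I (a i * β - α * b i) := by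
    intro i hi hm
    apply hn.inj
    rw [hθ']
    rw [← map_smul, ← map_smul, ← sub_eq_zero, ← map_sub, Submodule.mkQ_apply,
        Submodule.Quotient.mk_eq_zero, smul_eq_mul, smul_eq_mul]
    have := I.mul_mem_left α (hmin i hi)
    convert this using 1
    ring
  have hr2 : LinearMap.range (β • F - α • Ψ).hom =
      LinearMap.ker (quotMap I (I ⊔ Ideal.span ((fun i => a i * β - α * b i) '' s))
        le_sup_left) := by
    rw [quotMap_ker]
    apply le_antisymm
    · rintro _ ⟨⟨p, hp⟩, rfl⟩
      induction hp using Submodule.span_induction with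
      | mem x hx =>
        obtain ⟨_, ⟨i, hi, rfl⟩, rfl⟩ := hx
        rw [hgen i hi]
        exact Submodule.subset_span ⟨_, ⟨i, hi, rfl⟩, rfl⟩
      | zero =>
        have : (β • F - α • Ψ).hom (0 : P) = 0 := map_zero _
        erw [this]
        exact Submodule.zero_mem _
      | add x y hx hy h1 h2 =>
        have : (β • F - α • Ψ).hom ((⟨x, hx⟩ : P) + (⟨y, hy⟩ : P)) =
          (β • F - α • Ψ).hom (⟨x, hx⟩ : P) + (β • F - α • Ψ).hom (⟨y, hy⟩ : P) := map_add _ _ _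
        exact this ▸ Submodule.add_mem _ h1 h2
      | smul c x hx h1 =>
        have : (β • F - α • Ψ).hom (c • (⟨x, hx⟩ : P)) =
          c • (β • F - α • Ψ).hom (⟨x, hx⟩ : P) := map_smul _ _ _
        exact this ▸ Submodule.smul_mem _ c h1
    · rw [Submodule.span_le]
      rintro _ ⟨_, ⟨i, hi, rfl⟩, rfl⟩
      exact ⟨⟨Submodule.mkQ I (a i), Submodule.subset_span ⟨_, ⟨i, hi, rfl⟩, rfl⟩⟩, hgen i hi _⟩
  have w2 : (β • F - α • Ψ) ≫ ModuleCat.ofHom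
      (quotMap I (I ⊔ Ideal.span ((fun i => a i * β - α * b i) '' s)) le_sup_left) = 0 := by
    ext1
    refine LinearMap.ext fun x => ?_
    have : (β • F - α • Ψ).hom x ∈ LinearMap.ker (quotMap I
      (I ⊔ Ideal.span ((fun i => a i * β - α * b i) '' s)) le_sup_left) := hr2 ▸ ⟨x, rfl⟩
    exact this
  refine HProp.step F _ Ψ _ α β hα hβ w1 (shortExact_of _ _ w1 ?_ (quotMap_surj _ _ le_sup_left) hr1) w2
    (shortExact_of _ _ w2 ?_ (quotMap_surj _ _ le_sup_left) hr2) h.1 h'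
  · exact Subtype.val_injective
  · intro p q hpq
    apply Subtype.ext
    apply hg.inj
    rw [← hθ', ← hθ', hpq]

lemma HI.bot (k : ModuleCat.{u} R) [Nontrivial k] : HI k (⊥ : Ideal R) 0 := by
  have e : ModuleCat.of R R ≅ ModuleCat.of R (R ⧸ (⊥ : Ideal R)) :=
    (Submodule.quotEquivOfEqBot (⊥ : Ideal R) rfl).symm.toModuleIso
  refine HProp.of_iso e ?_
  have hp : Projective (ModuleCat.of R R) := ModuleCat.projective_of_free
    (M := ModuleCat.of R R) (Module.Basis.singleton Unit R)
  refine ⟨inferInstance, ?_⟩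
  obtain ⟨x, hx⟩ := exists_ne (0 : k)
  refine ⟨Abelian.Ext.mk₀ (ModuleCat.ofHom (LinearMap.toSpanSingleton R k x)), 0, fun h0 => hx ?_⟩
  have h1 : ModuleCat.ofHom (LinearMap.toSpanSingleton R k x) = 0 :=
    Abelian.Ext.homEquiv₀.symm.injective (by simpa using h0)
  have h2 := congrArg (fun f => f.hom (1 : R)) h1
  simpa using h2

end Ideals

set_option linter.unusedSectionVars false

section Toric

variable {K : Type*} [Field K] {E ι : Type} [Fintype E] [Fintype ι]

/-- exponent vector of the alternating monomial of path `i` -/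
def altExp (p : E → ι) (σ : E → Bool) (i : ι) (ε : Bool) : E →₀ ℕ :=
  Finsupp.equivFunOnFinite.symm (fun e => if p e = i ∧ σ e = ε then 1 else 0)

lemma altExp_apply (p : E → ι) (σ : E → Bool) (i : ι) (ε : Bool) (e : E) :
    altExp p σ i ε e = if p e = i ∧ σ e = ε then 1 else 0 := rfl

variable (K) in
/-- the alternating monomial of path `i` -/
def altMon (p : E → ι) (σ : E → Bool) (ε : Bool) (i : ι) : MvPolynomial E K :=
  monomial (altExp p σ i ε) 1

variable (K) in
/-- the binomial attached to two paths -/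
def minor (p : E → ι) (σ : E → Bool) (i j : ι) : MvPolynomial E K :=
  altMon K p σ true i * altMon K p σ false j - altMon K p σ true j * altMon K p σ false i

variable (K) in
/-- ideal of minors of a set of paths -/
def minorIdeal (p : E → ι) (σ : E → Bool) (s : Finset ι) : Ideal (MvPolynomial E K) :=
  Ideal.span {f | ∃ i ∈ s, ∃ j ∈ s, f = minor K p σ i j}

lemma minor_mem {p : E → ι} {σ : E → Bool} {s : Finset ι} {i j : ι} (hi : i ∈ s) (hj : j ∈ s) :
    minor K p σ i j ∈ minorIdeal K p σ s :=
  Ideal.subset_span ⟨i, hi, j, hj, rfl⟩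

/-- kernel of a monomial map -/
lemma ker_le_of_binomials {τ : Type*} (Φ : MvPolynomial E K →ₐ[K] MvPolynomial τ K)
    (φ : (E →₀ ℕ) → (τ →₀ ℕ)) (hΦ : ∀ u, Φ (monomial u 1) = monomial (φ u) 1)
    (I : Ideal (MvPolynomial E K))
    (h : ∀ u v, φ u = φ v → (monomial u 1 - monomial v 1 : MvPolynomial E K) ∈ I) :
    RingHom.ker Φ.toRingHom ≤ I := by
  let ρ : (τ →₀ ℕ) → (E →₀ ℕ) := Function.invFun φ
  have hρ : ∀ u, φ (ρ (φ u)) = φ u := fun u => Function.invFun_eq ⟨u, rfl⟩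
  let L : MvPolynomial τ K →ₗ[K] MvPolynomial E K :=
    (basisMonomials τ K).constr K (fun w => monomial (ρ w) 1)
  have hL : ∀ w, L (monomial w 1) = monomial (ρ w) 1 := by
    intro w
    have := (basisMonomials τ K).constr_basis K (fun w => (monomial (ρ w) 1 : MvPolynomial E K)) w
    rwa [coe_basisMonomials] at this
  have key : ∀ f, f - L (Φ f) ∈ I := by
    intro f
    induction f using MvPolynomial.induction_on' with
    | monomial u b =>
      have h1 : (monomial u b : MvPolynomial E K) = b • monomial u 1 := by
        rw [smul_monomial, smul_eq_mul, mul_one]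
      rw [h1, map_smul, map_smul, hΦ, hL, ← smul_sub]
      exact Submodule.smul_of_tower_mem I b (h _ _ (hρ _).symm)
    | add f g ih1 ih2 =>
      rw [map_add, map_add, add_sub_add_comm]
      exact I.add_mem ih1 ih2
  intro f hf
  have h0 : Φ f = 0 := hf
  have := key f
  rwa [h0, map_zero, sub_zero] at this

lemma exists_pm {s : Finset ι} {δ : ι → ℤ} (h : ∑ i ∈ s, δ i = 0) (hne : ∃ i ∈ s, δ i ≠ 0) :
    ∃ i ∈ s, ∃ j ∈ s, 0 < δ i ∧ δ j < 0 := by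
  obtain ⟨i, hi, hpos⟩ := Finset.exists_pos_of_sum_zero_of_exists_nonzero δ h hne
  obtain ⟨j, hj, hneg⟩ := Finset.exists_pos_of_sum_zero_of_exists_nonzero (fun i => - δ i)
    (s := s) (by rw [Finset.sum_neg_distrib, h, neg_zero]) (by simpa using hne)
  exact ⟨i, hi, j, hj, hpos, by linarith⟩

/-- sign of an edge -/
def sgn (b : Bool) : ℤ := if b then 1 else -1

lemma binomial_mem (p : E → ι) (σ : E → Bool) (s t : Finset ι) :
    ∀ (n : ℕ) (u v : E →₀ ℕ) (δ : ι → ℤ), (∑ i, (δ i).natAbs = n) →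
      (∀ e, (u e : ℤ) = v e + sgn (σ e) * δ (p e)) →
      (∑ i ∈ s, δ i = 0) → (∑ i ∈ t, δ i = 0) → (∀ i, i ∉ s → i ∉ t → δ i = 0) →
      Disjoint s t →
      (monomial u 1 - monomial v 1 : MvPolynomial E K) ∈ minorIdeal K p σ s ⊔ minorIdeal K p σ t := by
  intro n
  induction n using Nat.strong_induction_on with
  | _ n ih =>
  intro u v δ hn huv hs ht hst hd
  by_cases h0 : ∀ i, δ i = 0
  · have : u = v := by
      ext e
      have := huv e
      rw [h0, mul_zero, add_zero] at this
      exact_mod_cast this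
    rw [this, sub_self]
    exact Ideal.zero_mem _
  · push Not at h0
    obtain ⟨i₁, hi₁⟩ := h0
    obtain ⟨i, j, hpos, hneg, hmem, hsame⟩ : ∃ i j, 0 < δ i ∧ δ j < 0 ∧
        minor K p σ i j ∈ minorIdeal K p σ s ⊔ minorIdeal K p σ t ∧
        ((i ∈ s ∧ j ∈ s) ∨ (i ∈ t ∧ j ∈ t)) := by
      by_cases h1 : i₁ ∈ s
      · obtain ⟨i, hi, j, hj, h2, h3⟩ := exists_pm hs ⟨i₁, h1, hi₁⟩
        exact ⟨i, j, h2, h3, Ideal.mem_sup_left (minor_mem hi hj), Or.inl ⟨hi, hj⟩⟩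
      · have h1' : i₁ ∈ t := by
          by_contra h2
          exact hi₁ (hst i₁ h1 h2)
        obtain ⟨i, hi, j, hj, h2, h3⟩ := exists_pm ht ⟨i₁, h1', hi₁⟩
        exact ⟨i, j, h2, h3, Ideal.mem_sup_right (minor_mem hi hj), Or.inr ⟨hi, hj⟩⟩
    have hij : i ≠ j := by rintro rfl; omega
    have hle : altExp p σ i true + altExp p σ j false ≤ u := by
      intro e
      rw [Finsupp.add_apply, altExp_apply, altExp_apply]
      have := huv e
      by_cases h1 : p e = i ∧ σ e = true
      · have h2 : ¬ (p e = j ∧ σ e = false) := by rintro ⟨-, h⟩; rw [h1.2] at h; cases h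
        rw [if_pos h1, if_neg h2]
        rw [h1.1, h1.2] at this
        simp only [sgn, if_true] at this
        omega
      · rw [if_neg h1]
        by_cases h2 : p e = j ∧ σ e = false
        · rw [if_pos h2]
          rw [h2.1, h2.2] at this
          simp [sgn] at this
          omega
        · rw [if_neg h2]; omega
    obtain ⟨w, rfl⟩ := exists_add_of_le hle
    set u' := altExp p σ j true + altExp p σ i false + w with hu'
    have hdiff : (monomial (altExp p σ i true + altExp p σ j false + w) 1 - monomial u' 1 :
        MvPolynomial E K) ∈ minorIdeal K p σ s ⊔ minorIdeal K p σ t := by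
      have : (monomial (altExp p σ i true + altExp p σ j false + w) 1 - monomial u' 1 :
        MvPolynomial E K) = minor K p σ i j * monomial w 1 := by
        simp only [minor, altMon, sub_mul, monomial_mul, mul_one, hu']
      rw [this]
      exact Ideal.mul_mem_right _ _ hmem
    let δ' : ι → ℤ := fun x => δ x - (if x = i then 1 else 0) + (if x = j then 1 else 0)
    have hsum : ∀ r : Finset ι, ((i ∈ r ∧ j ∈ r) ∨ (i ∉ r ∧ j ∉ r)) →
        ∑ x ∈ r, δ' x = ∑ x ∈ r, δ x := by
      intro r hr
      simp only [δ', Finset.sum_add_distrib, Finset.sum_sub_distrib, Finset.sum_ite_eq']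
      rcases hr with hr | hr
      · rw [if_pos hr.1, if_pos hr.2]; ring
      · rw [if_neg hr.1, if_neg hr.2]; ring
    have hdis := Finset.disjoint_left.1 hd
    have hu'v := ih (∑ x, (δ' x).natAbs) ?_ u' v δ' rfl ?_ ?_ ?_ ?_ hd
    · have := Ideal.add_mem _ hdiff hu'v
      rwa [sub_add_sub_cancel] at this
    · rw [← hn]
      apply Finset.sum_lt_sum
      · intro x _
        simp only [δ']
        split_ifs with h1 h2 h2
        · subst h1; exact absurd h2 hij
        · subst h1; omega
        · subst h2; omega
        · simp
      · refine ⟨i, Finset.mem_univ _, ?_⟩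
        simp only [δ', if_true, if_neg hij]
        omega
    · intro e
      have := huv e
      simp only [Finsupp.add_apply, altExp_apply, hu', δ', sgn] at this ⊢
      rcases Bool.eq_false_or_eq_true (σ e) with h1 | h1
      · simp only [h1, if_true, and_true, Bool.true_eq_false, and_false, if_false] at this ⊢
        split_ifs at this ⊢ <;> push_cast at this ⊢ <;> linarith
      · simp only [h1, and_true, Bool.false_eq_true, and_false, if_false] at this ⊢
        split_ifs at this ⊢ <;> push_cast at this ⊢ <;> linarith
    · rw [hsum s, hs]
      rcases hsame with h | h
      · exact Or.inl h
      · exact Or.inr ⟨fun h1 => hdis h1 h.1, fun h1 => hdis h1 h.2⟩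
    · rw [hsum t, ht]
      rcases hsame with h | h
      · exact Or.inr ⟨fun h1 => hdis h.1 h1, fun h1 => hdis h.2 h1⟩
      · exact Or.inl h
    · intro x hx1 hx2
      have h1 : x ≠ i := by rintro rfl; tauto
      have h2 : x ≠ j := by rintro rfl; tauto
      simp [δ', h1, h2, hst x hx1 hx2]

/-- monomial algebra map attached to an additive map of exponents -/
lemma exists_monomial_map {τ : Type*} (φ : (E →₀ ℕ) →+ (τ →₀ ℕ)) :
    ∃ Φ : MvPolynomial E K →ₐ[K] MvPolynomial τ K,
      ∀ u, Φ (monomial u 1) = monomial (φ u) 1 := by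
  refine ⟨aeval (fun e => monomial (φ (Finsupp.single e 1)) 1), fun u => ?_⟩
  induction u using Finsupp.induction_linear with
  | zero =>
    rw [map_zero, show (monomial (0 : E →₀ ℕ) (1 : K)) = 1 from rfl, map_one]; rfl
  | add f g hf hg =>
    have : (monomial (f + g) (1 : K)) = monomial f 1 * monomial g 1 := by
      rw [monomial_mul, mul_one]
    rw [this, map_mul, hf, hg, monomial_mul, mul_one, map_add]
  | single e n =>
    have : (monomial (Finsupp.single e n) (1 : K)) = X e ^ n := by
      rw [X_pow_eq_monomial]
    rw [this, map_pow, aeval_X, monomial_pow, one_pow, ← map_nsmul, Finsupp.smul_single,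
      smul_eq_mul, mul_one]

end Toric

section Main

universe u

variable {K : Type u} [Field K] {E ι : Type} [Fintype E] [Fintype ι]

/-- multiplication by `g` commutes with division by the monomial `w` -/
def DC (w : E →₀ ℕ) (g : MvPolynomial E K) : Prop :=
  ∀ q : MvPolynomial E K, (q * g).divMonomial w = q.divMonomial w * g

lemma DC.mul {w : E →₀ ℕ} {g h : MvPolynomial E K} (hg : DC w g) (hh : DC w h) :
    DC w (g * h) := by
  intro q
  rw [← mul_assoc, hh, hg, mul_assoc]

lemma sub_divMon (w : E →₀ ℕ) (f g : MvPolynomial E K) :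
    (f - g).divMonomial w = f.divMonomial w - g.divMonomial w := by
  ext u
  simp [coeff_divMonomial, coeff_sub]

lemma DC.sub {w : E →₀ ℕ} {g h : MvPolynomial E K} (hg : DC w g) (hh : DC w h) :
    DC w (g - h) := by
  intro q
  rw [mul_sub, sub_divMon, hg, hh, mul_sub]

lemma DC.monomial {w w' : E →₀ ℕ} (h : ∀ e, w e = 0 ∨ w' e = 0) :
    DC w (MvPolynomial.monomial w' (1 : K)) := by
  intro q
  ext u
  rw [coeff_divMonomial, coeff_mul_monomial', coeff_mul_monomial', coeff_divMonomial]
  have h1 : w' ≤ w + u ↔ w' ≤ u := by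
    constructor
    · intro hh e
      have := hh e
      rw [Finsupp.add_apply] at this
      rcases h e with h | h <;> omega
    · intro hh e
      have := hh e
      rw [Finsupp.add_apply]; omega
  by_cases h2 : w' ≤ u
  · rw [if_pos h2, if_pos (h1.2 h2)]
    congr 2
    ext e
    have := h2 e
    simp only [Finsupp.add_apply, Finsupp.tsub_apply]
    omega
  · rw [if_neg h2, if_neg (fun h => h2 (h1.1 h))]

lemma NZ_of_DC (w : E →₀ ℕ) (S : Set (MvPolynomial E K)) (hS : ∀ g ∈ S, DC w g) :
    NZ (Ideal.span S) (MvPolynomial.monomial w (1 : K)) := by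
  have key : ∀ f ∈ Ideal.span S, ∀ q, (q * f).divMonomial w ∈ Ideal.span S := by
    intro f hf
    induction hf using Submodule.span_induction with
    | mem g hg =>
      intro q
      rw [hS g hg]
      exact Ideal.mul_mem_left _ _ (Ideal.subset_span hg)
    | zero => intro q; rw [mul_zero, zero_divMonomial]; exact Ideal.zero_mem _
    | add f g _ _ h1 h2 =>
      intro q
      rw [mul_add, add_divMonomial]
      exact Ideal.add_mem _ (h1 q) (h2 q)
    | smul a f _ h1 =>
      intro q
      rw [smul_eq_mul, ← mul_assoc]
      exact h1 _
  intro x hx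
  have := key _ hx 1
  rwa [one_mul, divMonomial_monomial_mul] at this

lemma DC_altMon (p : E → ι) (σ : E → Bool) {i j : ι} (hij : i ≠ j) (ε ε' : Bool) :
    DC (altExp p σ i ε) (altMon K p σ ε' j) := by
  apply DC.monomial
  intro e
  rw [altExp_apply, altExp_apply]
  by_cases h : p e = i
  · right
    rw [if_neg]
    rintro ⟨h1, -⟩
    exact hij (h.symm.trans h1)
  · left
    rw [if_neg]
    rintro ⟨h1, -⟩
    exact h h1

lemma NZ_reg (p : E → ι) (σ : E → Bool) (s t : Finset ι) (j : ι) (hs : j ∉ s) (ht : j ∉ t) :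
    NZ (minorIdeal K p σ t ⊔ Ideal.span (altMon K p σ true '' (s : Set ι)))
      (altMon K p σ true j) := by
  rw [minorIdeal, ← Ideal.span_union]
  apply NZ_of_DC
  rintro g (⟨i, hi, i', hi', rfl⟩ | ⟨i, hi, rfl⟩)
  · have h1 : j ≠ i := fun h => ht (h ▸ hi)
    have h2 : j ≠ i' := fun h => ht (h ▸ hi')
    exact ((DC_altMon p σ h1 _ _).mul (DC_altMon p σ h2 _ _)).sub
      ((DC_altMon p σ h2 _ _).mul (DC_altMon p σ h1 _ _))
  · have h1 : j ≠ i := fun h => hs (h ▸ hi)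
    exact DC_altMon p σ h1 _ _

lemma exists_prime_map (p : E → ι) (σ : E → Bool) (hσ : ∀ i b, ∃ e, p e = i ∧ σ e = b)
    (s t : Finset ι) (hd : Disjoint s t) :
    ∃ (τ : Type) (φ : (E →₀ ℕ) →+ (τ →₀ ℕ)) (Φ : MvPolynomial E K →ₐ[K] MvPolynomial τ K),
      (∀ u, Φ (monomial u 1) = monomial (φ u) 1) ∧
      (∀ x, Φ x = 0 → x ∈ minorIdeal K p σ s ⊔ minorIdeal K p σ t) ∧
      (∀ x ∈ minorIdeal K p σ s ⊔ minorIdeal K p σ t, Φ x = 0) ∧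
      (∀ u v, φ u = φ v → ∀ e, p e ∉ s → p e ∉ t → u e = v e) := by
  choose ed hed1 hed2 using hσ
  let F : (E →₀ ℕ) → ((E × E) ⊕ (Bool ⊕ E)) → ℕ := fun u =>
    Sum.elim (fun x => if p x.1 = p x.2 ∧ σ x.1 ≠ σ x.2 then u x.1 + u x.2 else 0)
      (Sum.elim (fun b => ∑ i ∈ (bif b then s else t), u (ed i true))
        (fun e => if p e ∉ s ∧ p e ∉ t then u e else 0))
  have hF : ∀ u v, F (u + v) = F u + F v := by
    intro u v
    funext x
    rcases x with x | b | e
    · simp only [F, Sum.elim_inl, Pi.add_apply, Finsupp.add_apply]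
      split_ifs <;> omega
    · simp only [F, Sum.elim_inl, Sum.elim_inr, Pi.add_apply, Finsupp.add_apply,
        Finset.sum_add_distrib]
    · simp only [F, Sum.elim_inr, Pi.add_apply, Finsupp.add_apply]
      split_ifs <;> omega
  have hF0 : F 0 = 0 := by
    funext x
    rcases x with x | b | e <;> simp [F]
  let φ : (E →₀ ℕ) →+ (((E × E) ⊕ (Bool ⊕ E)) →₀ ℕ) :=
    { toFun := fun u => Finsupp.equivFunOnFinite.symm (F u)
      map_zero' := by rw [hF0]; ext x; rfl
      map_add' := fun u v => by rw [hF]; ext x; rfl }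
  have hφ : ∀ u v, φ u = φ v ↔ F u = F v := fun u v =>
    Finsupp.equivFunOnFinite.symm.injective.eq_iff
  obtain ⟨Φ, hΦ⟩ := exists_monomial_map (K := K) φ
  have hker : RingHom.ker Φ.toRingHom ≤ minorIdeal K p σ s ⊔ minorIdeal K p σ t := by
    apply ker_le_of_binomials Φ φ hΦ
    intro u v huv
    rw [hφ] at huv
    let δ : ι → ℤ := fun i => (u (ed i true) : ℤ) - v (ed i true)
    have hpair : ∀ e f, p e = p f → σ e ≠ σ f → u e + u f = v e + v f := by
      intro e f h1 h2
      have := congrFun huv (Sum.inl (e, f))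
      simpa only [F, Sum.elim_inl, if_pos (And.intro h1 h2)] using this
    have hsum : ∀ b : Bool, ∑ i ∈ (bif b then s else t), δ i = 0 := by
      intro b
      have := congrFun huv (Sum.inr (Sum.inl b))
      simp only [F, Sum.elim_inl, Sum.elim_inr] at this
      simp only [δ, Finset.sum_sub_distrib]
      rw [sub_eq_zero]
      exact_mod_cast this
    refine binomial_mem p σ s t _ u v δ rfl ?_ (hsum true) (hsum false) ?_ hd
    · intro e
      have h3 := hpair (ed (p e) true) (ed (p e) false) (by rw [hed1, hed1])
        (by rw [hed2, hed2]; simp)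
      simp only [δ, sgn]
      by_cases h : σ e = true
      · have h1 := hpair e (ed (p e) false) (by rw [hed1]) (by rw [hed2, h]; simp)
        rw [if_pos h]
        omega
      · have h1 := hpair e (ed (p e) true) (by rw [hed1]) (by rw [hed2]; exact h)
        rw [if_neg h]
        omega
    · intro i h1 h2
      have := congrFun huv (Sum.inr (Sum.inr (ed i true)))
      simp only [F, Sum.elim_inr, hed1, if_pos (And.intro h1 h2)] at this
      simp only [δ]
      omega
  have hminor : ∀ b : Bool, ∀ i ∈ (bif b then s else t), ∀ j ∈ (bif b then s else t),
      F (altExp p σ i true + altExp p σ j false) = F (altExp p σ j true + altExp p σ i false) := by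
    intro b i hi j hj
    have hst : ∀ x ∈ (bif b then s else t), ∀ b', x ∈ (bif b' then s else t) → b' = b := by
      intro x hx b' hx'
      have := Finset.disjoint_left.1 hd
      cases b <;> cases b' <;> simp at hx hx' ⊢
      · exact this hx' hx
      · exact this hx hx'
    funext x
    rcases x with ⟨e, f⟩ | b' | e
    · simp only [F, Sum.elim_inl, Finsupp.add_apply, altExp_apply]
      by_cases h : p e = p f ∧ σ e ≠ σ f
      · rw [if_pos h, if_pos h]
        obtain ⟨h1, h2⟩ := h
        rw [h1]
        cases h3 : σ e <;> cases h4 : σ f <;> simp [h3, h4] at h2 ⊢ <;> omega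
      · rw [if_neg h, if_neg h]
    · simp only [F, Sum.elim_inl, Sum.elim_inr, Finsupp.add_apply, altExp_apply, hed1, hed2]
      simp only [and_true, Bool.true_eq_false, and_false, if_false, add_zero,
        Finset.sum_ite_eq']
      by_cases hb : b' = b
      · subst hb
        rw [if_pos hi, if_pos hj]
      · rw [if_neg (fun h => hb (hst i hi b' h)), if_neg (fun h => hb (hst j hj b' h))]
    · simp only [F, Sum.elim_inr, Finsupp.add_apply, altExp_apply]
      by_cases h : p e ∉ s ∧ p e ∉ t
      · have h1 : p e ≠ i := by
          rintro rfl; cases b <;> simp_all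
        have h2 : p e ≠ j := by
          rintro rfl; cases b <;> simp_all
        simp [h1, h2]
      · rw [if_neg h, if_neg h]
  have hle : minorIdeal K p σ s ⊔ minorIdeal K p σ t ≤ RingHom.ker Φ.toRingHom := by
    have : ∀ b : Bool, minorIdeal K p σ (bif b then s else t) ≤ RingHom.ker Φ.toRingHom := by
      intro b
      rw [minorIdeal, Ideal.span_le]
      rintro _ ⟨i, hi, j, hj, rfl⟩
      change Φ _ = 0
      rw [minor, altMon, altMon, altMon, altMon, monomial_mul, monomial_mul, map_sub, mul_one,
        hΦ, hΦ, (hφ _ _).2 (hminor b i hi j hj), sub_self]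
    exact sup_le (this true) (this false)
  refine ⟨_, φ, Φ, hΦ, fun x hx => hker hx, fun x hx => hle hx, ?_⟩
  intro u v huv e h1 h2
  rw [hφ] at huv
  have := congrFun huv (Sum.inr (Sum.inr e))
  simpa only [F, Sum.elim_inr, if_pos (And.intro h1 h2)] using this

lemma NZ_prime1 (p : E → ι) (σ : E → Bool) (hσ : ∀ i b, ∃ e, p e = i ∧ σ e = b)
    (s t : Finset ι) (hd : Disjoint s t) (i : ι) :
    NZ (minorIdeal K p σ s ⊔ minorIdeal K p σ t) (altMon K p σ true i) := by
  obtain ⟨τ, φ, Φ, hΦ, h1, h2, -⟩ := exists_prime_map (K := K) p σ hσ s t hd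
  intro x hx
  have := h2 _ hx
  rw [map_mul, altMon, hΦ, mul_eq_zero] at this
  rcases this with h | h
  · rw [monomial_eq_zero] at h
    exact absurd h one_ne_zero
  · exact h1 x h

lemma NZ_prime2 (p : E → ι) (σ : E → Bool) (hσ : ∀ i b, ∃ e, p e = i ∧ σ e = b)
    (s t : Finset ι) (hd : Disjoint s t) (i j : ι) (hi : i ∈ s) (hjs : j ∉ s) (hjt : j ∉ t) :
    NZ (minorIdeal K p σ s ⊔ minorIdeal K p σ t)
      (altMon K p σ true i * altMon K p σ false j - altMon K p σ true j * altMon K p σ false i) := by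
  obtain ⟨τ, φ, Φ, hΦ, h1, h2, h3⟩ := exists_prime_map (K := K) p σ hσ s t hd
  intro x hx
  have := h2 _ hx
  rw [map_mul, mul_eq_zero] at this
  rcases this with h | h
  · exfalso
    rw [altMon, altMon, altMon, altMon, monomial_mul, monomial_mul, map_sub, mul_one,
        hΦ, hΦ, sub_eq_zero] at h
    have h4 := monomial_left_injective (R := K) one_ne_zero h
    obtain ⟨e, he1, he2⟩ := hσ j true
    have h5 := h3 _ _ h4 e (by rwa [he1]) (by rwa [he1])
    have hij : j ≠ i := fun h => hjs (h ▸ hi)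
    simp [altExp_apply, he1, he2, hij] at h5
  · exact h1 x h

variable {k : ModuleCat.{u} (MvPolynomial E K)}

lemma HI_reg_many (p : E → ι) (σ : E → Bool) (hk : ∀ b i, altMon K p σ b i • 𝟙 k = 0)
    (t : Finset ι) (q : ℕ) (h : HI k (minorIdeal K p σ t) q) (s : Finset ι) :
    Disjoint s t →
    HI k (minorIdeal K p σ t ⊔ Ideal.span (altMon K p σ true '' (s : Set ι))) (q + s.card) := by
  induction s using Finset.induction_on with
  | empty =>
    intro _
    simpa using h
  | insert j s hj ih =>
    intro hd
    rw [Finset.disjoint_insert_left] at hd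
    have := HI.reg _ (hk true j) (NZ_reg p σ s t j hj hd.1) (ih hd.2)
    rw [sup_assoc, ← Ideal.span_union] at this
    rw [Finset.card_insert_of_notMem hj, Finset.coe_insert, Set.image_insert_eq,
      Set.insert_eq, Set.union_comm]
    exact this

lemma minorIdeal_singleton (p : E → ι) (σ : E → Bool) (i : ι) : minorIdeal K p σ {i} = ⊥ := by
  rw [minorIdeal, Ideal.span_eq_bot]
  rintro _ ⟨a, ha, b, hb, rfl⟩
  rw [Finset.mem_singleton.1 ha, Finset.mem_singleton.1 hb, minor, sub_self]

lemma minorIdeal_empty (p : E → ι) (σ : E → Bool) : minorIdeal K p σ ∅ = ⊥ := by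
  rw [minorIdeal, Ideal.span_eq_bot]
  rintro _ ⟨a, ha, b, hb, rfl⟩
  simp at ha

lemma minorIdeal_le (p : E → ι) (σ : E → Bool) (s : Finset ι) :
    minorIdeal K p σ s ≤ Ideal.span (altMon K p σ true '' (s : Set ι)) := by
  rw [minorIdeal, Ideal.span_le]
  rintro _ ⟨i, hi, j, hj, rfl⟩
  exact Ideal.sub_mem _ (Ideal.mul_mem_right _ _ (Ideal.subset_span ⟨i, hi, rfl⟩))
    (Ideal.mul_mem_right _ _ (Ideal.subset_span ⟨j, hj, rfl⟩))

lemma minorIdeal_insert (p : E → ι) (σ : E → Bool) (s : Finset ι) (j : ι) :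
    minorIdeal K p σ (insert j s) = minorIdeal K p σ s ⊔
      Ideal.span ((fun i => altMon K p σ true i * altMon K p σ false j -
        altMon K p σ true j * altMon K p σ false i) '' (s : Set ι)) := by
  apply le_antisymm
  · rw [minorIdeal, Ideal.span_le]
    rintro _ ⟨a, ha, b, hb, rfl⟩
    rw [SetLike.mem_coe]
    rcases Finset.mem_insert.1 ha with rfl | ha' <;>
      rcases Finset.mem_insert.1 hb with rfl | hb'
    · rw [minor, sub_self]; exact Ideal.zero_mem _
    · apply Ideal.mem_sup_right
      rw [minor, ← neg_sub]
      exact Ideal.neg_mem_iff _ |>.2 (Ideal.subset_span ⟨b, hb', rfl⟩)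
    · apply Ideal.mem_sup_right
      exact Ideal.subset_span ⟨a, ha', rfl⟩
    · exact Ideal.mem_sup_left (minor_mem ha' hb')
  · apply sup_le
    · rw [minorIdeal, Ideal.span_le]
      rintro _ ⟨a, ha, b, hb, rfl⟩
      exact minor_mem (Finset.mem_insert_of_mem ha) (Finset.mem_insert_of_mem hb)
    · rw [Ideal.span_le]
      rintro _ ⟨a, ha, rfl⟩
      exact minor_mem (Finset.mem_insert_of_mem ha) (Finset.mem_insert_self _ _)

lemma HI_add (p : E → ι) (σ : E → Bool) (hσ : ∀ i b, ∃ e, p e = i ∧ σ e = b)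
    (hk : ∀ b i, altMon K p σ b i • 𝟙 k = 0)
    (t : Finset ι) (q : ℕ) (h : HI k (minorIdeal K p σ t) q) (s : Finset ι) :
    Disjoint s t →
    HI k (minorIdeal K p σ s ⊔ minorIdeal K p σ t) (q + (s.card - 1)) := by
  induction s using Finset.induction_on with
  | empty =>
    intro _
    simpa [minorIdeal_empty] using h
  | insert j s hj ih =>
    intro hd
    rw [Finset.disjoint_insert_left] at hd
    rcases s.eq_empty_or_nonempty with rfl | ⟨i₀, hi₀⟩
    · simpa [minorIdeal_singleton] using h
    · have hpos : 0 < s.card := Finset.card_pos.2 ⟨i₀, hi₀⟩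
      have h1 := HI_reg_many p σ hk t q h s hd.2
      have h2 := HI.step (s : Set ι) (altMon K p σ true) (altMon K p σ false) i₀
        (altMon K p σ true j) (altMon K p σ false j) (hk _ _) (hk _ _)
        (I := minorIdeal K p σ s ⊔ minorIdeal K p σ t) (r := q + (s.card - 1))
        (fun i hi => Ideal.mem_sup_left (minor_mem hi₀ hi))
        (NZ_prime1 p σ hσ s t hd.2 i₀) (NZ_prime2 p σ hσ s t hd.2 i₀ j hi₀ hj hd.1)
        (ih hd.2) (by
          have h3 : minorIdeal K p σ s ⊔ minorIdeal K p σ t ⊔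
              Ideal.span (altMon K p σ true '' (s : Set ι)) =
              minorIdeal K p σ t ⊔ Ideal.span (altMon K p σ true '' (s : Set ι)) := by
            rw [sup_comm (minorIdeal K p σ s), sup_assoc, sup_eq_right.2 (minorIdeal_le p σ s)]
          rw [h3, show q + (s.card - 1) + 1 = q + s.card by omega]
          exact h1)
      rw [minorIdeal_insert, Finset.card_insert_of_notMem hj, sup_right_comm,
        show q + (s.card + 1 - 1) = q + (s.card - 1) + 1 by omega]
      exact h2

lemma projDim_minor (p : E → ι) (σ : E → Bool) (hσ : ∀ i b, ∃ e, p e = i ∧ σ e = b)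
    (s t : Finset ι) (hd : Disjoint s t) :
    projDim (MvPolynomial E K) (ModuleCat.of (MvPolynomial E K)
      (MvPolynomial E K ⧸ (minorIdeal K p σ s ⊔ minorIdeal K p σ t))) =
      (((t.card - 1) + (s.card - 1) : ℕ) : ℕ∞) := by
  let m : Ideal (MvPolynomial E K) := RingHom.ker (constantCoeff (R := K) (σ := E))
  let k : ModuleCat.{u} (MvPolynomial E K) := ModuleCat.of _ (MvPolynomial E K ⧸ m)
  have hne : m ≠ ⊤ := RingHom.ker_ne_top _
  haveI : Nontrivial k := Ideal.Quotient.nontrivial_iff.2 hne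
  have hk : ∀ b i, altMon K p σ b i • 𝟙 k = 0 := by
    intro b i
    have hm : altMon K p σ b i ∈ m := by
      change constantCoeff _ = 0
      rw [altMon, constantCoeff_monomial, if_neg]
      intro h0
      obtain ⟨e, he⟩ := hσ i b
      have := DFunLike.congr_fun h0 e
      rw [altExp_apply, if_pos he] at this
      simp at this
    apply ModuleCat.hom_ext
    apply LinearMap.ext
    intro x
    change altMon K p σ b i • x = 0
    obtain ⟨y, rfl⟩ := Ideal.Quotient.mk_surjective x
    change Ideal.Quotient.mk m (altMon K p σ b i * y) = 0
    exact Ideal.Quotient.eq_zero_iff_mem.2 (Ideal.mul_mem_right _ _ hm)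
  have h0 : HI k (minorIdeal K p σ (∅ : Finset ι)) 0 := by
    rw [minorIdeal_empty]; exact HI.bot k
  have h1 := HI_add p σ hσ hk ∅ 0 h0 t (Finset.disjoint_empty_right _)
  rw [minorIdeal_empty, sup_bot_eq, zero_add] at h1
  exact projDim_eq k _ _ (HI_add p σ hσ hk t _ h1 s hd)

end Main

section Graph

variable {N : ℕ} {c : Fin N → ℕ}

/-- index type of the edges -/
abbrev EI (c : Fin N → ℕ) : Type := Σ i : Fin N, Fin (c i + 1)

/-- first endpoint of an edge -/
def lo (x : EI c) : MPV c :=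
  Fin.cases (motive := fun _ => MPV c) (Sum.inl 0) (fun b => Sum.inr ⟨x.1, b⟩) x.2

/-- second endpoint of an edge -/
def hi (x : EI c) : MPV c :=
  Fin.lastCases (motive := fun _ => MPV c) (Sum.inl 1) (fun b => Sum.inr ⟨x.1, b⟩) x.2

lemma lo_zero (i : Fin N) : lo (c := c) ⟨i, 0⟩ = Sum.inl 0 := rfl
lemma lo_succ (i : Fin N) (b : Fin (c i)) : lo (c := c) ⟨i, b.succ⟩ = Sum.inr ⟨i, b⟩ := rfl
lemma hi_last (i : Fin N) : hi (c := c) ⟨i, Fin.last _⟩ = Sum.inl 1 := by simp [hi]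
lemma hi_castSucc (i : Fin N) (b : Fin (c i)) :
    hi (c := c) ⟨i, b.castSucc⟩ = Sum.inr ⟨i, b⟩ := by simp [hi]

lemma lo_eq_inr (x : EI c) (y : Σ i : Fin N, Fin (c i)) :
    lo x = Sum.inr y ↔ x = ⟨y.1, y.2.succ⟩ := by
  obtain ⟨i, j⟩ := x
  obtain ⟨a, b⟩ := y
  constructor
  · intro h
    induction j using Fin.cases with
    | zero => rw [lo_zero] at h; cases h
    | succ j => rw [lo_succ] at h; cases h; rfl
  · intro h
    rw [h]; rfl

lemma hi_eq_inr (x : EI c) (y : Σ i : Fin N, Fin (c i)) :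
    hi x = Sum.inr y ↔ x = ⟨y.1, y.2.castSucc⟩ := by
  obtain ⟨i, j⟩ := x
  obtain ⟨a, b⟩ := y
  constructor
  · intro h
    induction j using Fin.lastCases with
    | last => rw [hi_last] at h; cases h
    | cast j => rw [hi_castSucc] at h; cases h; rfl
  · intro h
    rw [h, hi_castSucc]

lemma lo_eq_inl (i : Fin N) (j : Fin (c i + 1)) (a : Fin 2) :
    lo (c := c) ⟨i, j⟩ = Sum.inl a ↔ a = 0 ∧ j = 0 := by
  induction j using Fin.cases with
  | zero => simp [lo_zero, eq_comm]
  | succ j => simp [lo_succ]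

lemma hi_eq_inl (i : Fin N) (j : Fin (c i + 1)) (a : Fin 2) :
    hi (c := c) ⟨i, j⟩ = Sum.inl a ↔ a = 1 ∧ j = Fin.last _ := by
  induction j using Fin.lastCases with
  | last => simp [hi_last, eq_comm]
  | cast j => simp [hi_castSucc, Fin.castSucc_ne_last]

/-- the edge with given index -/
def edgeOf (x : EI c) : Sym2 (MPV c) := s(lo x, hi x)

lemma edgeOf_mem (hc : ∀ i, 1 ≤ c i) (x : EI c) : edgeOf x ∈ (multiPath c).edgeSet := by
  obtain ⟨i, j⟩ := x
  rw [edgeOf, SimpleGraph.mem_edgeSet, multiPath, SimpleGraph.fromRel_adj]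
  induction j using Fin.cases with
  | zero =>
    have h0 : (0 : Fin (c i + 1)) = Fin.castSucc (⟨0, hc i⟩ : Fin (c i)) := rfl
    rw [lo_zero, h0, hi_castSucc]
    exact ⟨by simp, Or.inl (Or.inl ⟨rfl, rfl⟩)⟩
  | succ b =>
    rw [lo_succ]
    by_cases hb : (b : ℕ) + 1 = c i
    · have h0 : b.succ = Fin.last (c i) := Fin.ext hb
      rw [h0, hi_last]
      exact ⟨by simp, Or.inr (Or.inr ⟨rfl, hb⟩)⟩
    · have h0 : b.succ = Fin.castSucc (⟨b + 1, by omega⟩ : Fin (c i)) := rfl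
      rw [h0, hi_castSucc]
      refine ⟨?_, Or.inl ⟨rfl, rfl⟩⟩
      intro h
      have h1 := eq_of_heq (Sigma.mk.inj (Sum.inr.inj h)).2
      have h2 := congrArg Fin.val h1
      simp at h2

lemma edgeOf_inj (hc : ∀ i, 1 ≤ c i) : Function.Injective (edgeOf (c := c)) := by
  intro x y h
  rw [edgeOf, edgeOf, Sym2.eq_iff] at h
  rcases h with ⟨h1, h2⟩ | ⟨h1, h2⟩
  · rcases hx : lo x with a | z
    · rcases hx' : hi x with a' | z'
      · obtain ⟨i, j⟩ := x
        rw [lo_eq_inl] at hx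
        rw [hi_eq_inl] at hx'
        have := congrArg Fin.val (hx.2.symm.trans hx'.2)
        have := hc i
        simp at *
        omega
      · rw [hx'] at h2
        rw [(hi_eq_inr x z').1 hx', (hi_eq_inr y z').1 h2.symm]
    · rw [hx] at h1
      rw [(lo_eq_inr x z).1 hx, (lo_eq_inr y z).1 h1.symm]
  · exfalso
    rcases hx : lo x with a | z
    · rw [hx] at h1
      rw [lo_eq_inl] at hx
      have := (hi_eq_inl y.1 y.2 a).1 h1.symm
      rw [hx.1] at this
      simp at this
    · rcases hx' : hi x with a | z'
      · rw [hx'] at h2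
        rw [hi_eq_inl] at hx'
        have := (lo_eq_inl y.1 y.2 a).1 h2.symm
        rw [hx'.1] at this
        simp at this
      · rw [hx] at h1
        rw [hx'] at h2
        have e1 := (lo_eq_inr x z).1 hx
        have e2 := (hi_eq_inr x z').1 hx'
        have e3 := (hi_eq_inr y z).1 h1.symm
        have e4 := (lo_eq_inr y z').1 h2.symm
        have f1 : ((x.2 : Fin _) : ℕ) = z.2 + 1 := by rw [e1]; rfl
        have f2 : ((x.2 : Fin _) : ℕ) = z'.2 := by rw [e2]; rfl
        have f3 : ((y.2 : Fin _) : ℕ) = z.2 := by rw [e3]; rfl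
        have f4 : ((y.2 : Fin _) : ℕ) = z'.2 + 1 := by rw [e4]; rfl
        omega

lemma edgeOf_surj_aux (a b : MPV c) (h : mpRel c a b) : ∃ x : EI c, edgeOf x = s(a, b) := by
  rcases a with a | ⟨i, j⟩ <;> rcases b with b | ⟨i', j'⟩
  · exact h.elim
  · rcases h with ⟨rfl, h⟩ | ⟨rfl, h⟩
    · refine ⟨⟨i', j'.castSucc⟩, ?_⟩
      rw [edgeOf, hi_castSucc, (lo_eq_inl _ _ 0).2 ⟨rfl, Fin.ext h⟩]
    · refine ⟨⟨i', j'.succ⟩, ?_⟩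
      rw [edgeOf, lo_succ, (hi_eq_inl _ _ 1).2 ⟨rfl, Fin.ext h⟩, Sym2.eq_swap]
  · exact h.elim
  · obtain ⟨h1, h2⟩ := h
    obtain rfl := Fin.ext h1
    refine ⟨⟨i, j.succ⟩, ?_⟩
    have h0 : j.succ = j'.castSucc := Fin.ext h2.symm
    rw [edgeOf, lo_succ, h0, hi_castSucc]

/-- indexing of the edges -/
def edgeEquiv (hc : ∀ i, 1 ≤ c i) : EI c ≃ (multiPath c).edgeSet :=
  Equiv.ofBijective (fun x => ⟨edgeOf x, edgeOf_mem hc x⟩) (by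
    constructor
    · intro x y h
      exact edgeOf_inj hc (congrArg Subtype.val h)
    · rintro ⟨e, he⟩
      induction e using Sym2.ind with
      | _ a b =>
      rw [SimpleGraph.mem_edgeSet, multiPath, SimpleGraph.fromRel_adj] at he
      rcases he.2 with h | h
      · obtain ⟨x, hx⟩ := edgeOf_surj_aux a b h
        exact ⟨x, Subtype.ext hx⟩
      · obtain ⟨x, hx⟩ := edgeOf_surj_aux b a h
        exact ⟨x, Subtype.ext (hx.trans Sym2.eq_swap)⟩)

/-- exponent map of the edge homomorphism -/
def phi (hc : ∀ i, 1 ≤ c i) (u : (multiPath c).edgeSet →₀ ℕ) : MPV c →₀ ℕ :=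
  ∑ x : EI c, u (edgeEquiv hc x) • (Finsupp.single (lo x) 1 + Finsupp.single (hi x) 1)

lemma edgeHom_monomial {K : Type*} [Field K] (hc : ∀ i, 1 ≤ c i)
    (u : (multiPath c).edgeSet →₀ ℕ) :
    edgeHom K (multiPath c) (monomial u 1) = monomial (phi hc u) 1 := by
  haveI : Fintype (multiPath c).edgeSet := Fintype.ofFinite _
  rw [edgeHom, aeval_monomial, map_one, one_mul, Finsupp.prod_fintype _ _ (fun _ => pow_zero _),
    phi, monomial_sum_one]
  refine (Fintype.prod_equiv (edgeEquiv hc) _ _ (fun x => ?_)).symm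
  have : edgeMon K ((edgeEquiv hc x : (multiPath c).edgeSet) : Sym2 (MPV c)) =
      monomial (Finsupp.single (lo x) 1 + Finsupp.single (hi x) 1) 1 := by
    change X (lo x) * X (hi x) = _
    rw [X, X, monomial_mul, mul_one]
  rw [this, monomial_pow, one_pow]

lemma phi_apply (hc : ∀ i, 1 ≤ c i) (u : (multiPath c).edgeSet →₀ ℕ) (w : MPV c) :
    phi hc u w = (∑ x : EI c, if lo x = w then u (edgeEquiv hc x) else 0) +
      ∑ x : EI c, if hi x = w then u (edgeEquiv hc x) else 0 := by
  rw [phi, Finsupp.finsetSum_apply, ← Finset.sum_add_distrib]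
  refine Finset.sum_congr rfl (fun x _ => ?_)
  rw [Finsupp.smul_apply, Finsupp.add_apply, Finsupp.single_apply, Finsupp.single_apply,
    smul_eq_mul, mul_add, mul_ite, mul_ite, mul_one, mul_zero]

lemma phi_inr (hc : ∀ i, 1 ≤ c i) (u : (multiPath c).edgeSet →₀ ℕ) (i : Fin N) (b : Fin (c i)) :
    phi hc u (Sum.inr ⟨i, b⟩) = u (edgeEquiv hc ⟨i, b.succ⟩) + u (edgeEquiv hc ⟨i, b.castSucc⟩) := by
  rw [phi_apply]
  simp only [lo_eq_inr, hi_eq_inr, Finset.sum_ite_eq', Finset.mem_univ, if_true]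

lemma phi_inl0 (hc : ∀ i, 1 ≤ c i) (u : (multiPath c).edgeSet →₀ ℕ) :
    phi hc u (Sum.inl 0) = ∑ i, u (edgeEquiv hc ⟨i, 0⟩) := by
  rw [phi_apply, Fintype.sum_sigma, Fintype.sum_sigma]
  simp [lo_eq_inl, hi_eq_inl]

lemma phi_inl1 (hc : ∀ i, 1 ≤ c i) (u : (multiPath c).edgeSet →₀ ℕ) :
    phi hc u (Sum.inl 1) = ∑ i, u (edgeEquiv hc ⟨i, Fin.last _⟩) := by
  rw [phi_apply, Fintype.sum_sigma, Fintype.sum_sigma]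
  simp [lo_eq_inl, hi_eq_inl]

/-- path of an edge -/
def pth (hc : ∀ i, 1 ≤ c i) (e : (multiPath c).edgeSet) : Fin N := ((edgeEquiv hc).symm e).1

/-- parity of the position of an edge -/
def par (hc : ∀ i, 1 ≤ c i) (e : (multiPath c).edgeSet) : Bool :=
  decide (Even (((edgeEquiv hc).symm e).2 : ℕ))

lemma pth_apply (hc : ∀ i, 1 ≤ c i) (x : EI c) : pth hc (edgeEquiv hc x) = x.1 := by
  rw [pth, Equiv.symm_apply_apply]

lemma par_apply (hc : ∀ i, 1 ≤ c i) (x : EI c) :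
    par hc (edgeEquiv hc x) = decide (Even (x.2 : ℕ)) := by
  rw [par, Equiv.symm_apply_apply]

lemma toric_eq {K : Type*} [Field K] [Fintype (multiPath c).edgeSet] (hc : ∀ i, 1 ≤ c i) :
    toricIdeal K (multiPath c) =
      minorIdeal K (pth hc) (par hc) (univ.filter (fun i => ¬ Even (c i))) ⊔
      minorIdeal K (pth hc) (par hc) (univ.filter (fun i => Even (c i))) := by
  apply le_antisymm
  · apply ker_le_of_binomials (edgeHom K (multiPath c)) (phi hc) (edgeHom_monomial hc)
    intro u v huv
    let δ : Fin N → ℤ := fun i => (u (edgeEquiv hc ⟨i, 0⟩) : ℤ) - v (edgeEquiv hc ⟨i, 0⟩)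
    have hpath : ∀ (i : Fin N) (j : Fin (c i + 1)), (u (edgeEquiv hc ⟨i, j⟩) : ℤ) =
        v (edgeEquiv hc ⟨i, j⟩) + sgn (decide (Even (j : ℕ))) * δ i := by
      intro i j
      induction j using Fin.induction with
      | zero => simp [sgn, δ]
      | succ b ih =>
        have h1 := DFunLike.congr_fun huv (Sum.inr ⟨i, b⟩)
        rw [phi_inr, phi_inr] at h1
        have h2 : sgn (decide (Even (b.succ : ℕ))) = - sgn (decide (Even (b.castSucc : ℕ))) := by
          rw [Fin.val_succ, Fin.val_castSucc, sgn, sgn]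
          by_cases h : Even (b : ℕ) <;> simp [h, Nat.even_add_one]
        rw [h2]
        zify at h1
        linarith
    have hs0 : ∑ i, δ i = 0 := by
      have h1 := DFunLike.congr_fun huv (Sum.inl 0)
      rw [phi_inl0, phi_inl0] at h1
      simp only [δ, Finset.sum_sub_distrib]
      rw [sub_eq_zero]
      exact_mod_cast h1
    have hs1 : ∑ i, sgn (decide (Even (c i))) * δ i = 0 := by
      have h1 := DFunLike.congr_fun huv (Sum.inl 1)
      rw [phi_inl1, phi_inl1] at h1
      have h2 : ∀ i, sgn (decide (Even (c i))) * δ i =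
          (u (edgeEquiv hc ⟨i, Fin.last _⟩) : ℤ) - v (edgeEquiv hc ⟨i, Fin.last _⟩) := by
        intro i
        have := hpath i (Fin.last _)
        rw [Fin.val_last] at this
        linarith
      simp only [h2, Finset.sum_sub_distrib]
      rw [sub_eq_zero]
      exact_mod_cast h1
    rw [← Finset.sum_filter_add_sum_filter_not univ (fun i => Even (c i))] at hs0 hs1
    rw [Finset.sum_congr rfl (g := δ) (fun i hi => by
        rw [decide_eq_true (Finset.mem_filter.1 hi).2, sgn, if_pos rfl, one_mul]),
      Finset.sum_congr rfl (s₁ := univ.filter (fun i => ¬ Even (c i))) (g := fun i => - δ i)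
      (fun i hi => by
        rw [decide_eq_false (Finset.mem_filter.1 hi).2, sgn]; simp),
      Finset.sum_neg_distrib] at hs1
    refine binomial_mem (pth hc) (par hc) _ _ _ u v δ rfl ?_ (by linarith) (by linarith) ?_ ?_
    · intro e
      obtain ⟨x, rfl⟩ := (edgeEquiv hc).surjective e
      rw [pth_apply, par_apply]
      exact hpath x.1 x.2
    · intro i h1 h2
      simp at h1 h2
      exact absurd h1 (by simpa using h2)
    · exact (Finset.disjoint_filter_filter_not _ _ _).symm
  · have key : ∀ i j, (Even (c i) ↔ Even (c j)) →
        minor K (pth hc) (par hc) i j ∈ toricIdeal K (multiPath c) := by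
      intro i j hij
      change edgeHom K (multiPath c) _ = 0
      rw [minor, altMon, altMon, altMon, altMon, monomial_mul, monomial_mul, map_sub, mul_one,
        edgeHom_monomial hc, edgeHom_monomial hc, sub_eq_zero]
      congr 2
      ext w
      rcases w with a | ⟨a, b⟩
      · fin_cases a
        · change phi hc _ (Sum.inl 0) = phi hc _ (Sum.inl 0)
          rw [phi_inl0, phi_inl0]
          simp [altExp_apply, pth_apply, par_apply, Finset.sum_add_distrib]
        · change phi hc _ (Sum.inl 1) = phi hc _ (Sum.inl 1)
          rw [phi_inl1, phi_inl1]
          simp only [Finsupp.add_apply, altExp_apply, pth_apply, par_apply, Fin.val_last,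
            Finset.sum_add_distrib, ite_and, Finset.sum_ite_eq', Finset.mem_univ, if_true,
            decide_eq_true_eq, decide_eq_false_iff_not]
          by_cases h : Even (c i)
          · simp [h, hij.1 h]
          · have h' : ¬ Even (c j) := fun h' => h (hij.2 h')
            simp only [h, h', if_false, not_false_eq_true, if_true, ite_self]
      · rw [phi_inr, phi_inr]
        simp only [Finsupp.add_apply, altExp_apply, pth_apply, par_apply, Fin.val_succ,
          Fin.val_castSucc, decide_eq_true_eq, decide_eq_false_iff_not, Nat.even_add_one, not_not]
        by_cases h : Even (b : ℕ) <;> simp [h] <;> omega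
    apply sup_le
    · rw [minorIdeal, Ideal.span_le]
      rintro _ ⟨i, hi, j, hj, rfl⟩
      simp at hi hj
      exact key i j (by simp [← Nat.not_odd_iff_even, hi, hj])
    · rw [minorIdeal, Ideal.span_le]
      rintro _ ⟨i, hi, j, hj, rfl⟩
      simp at hi hj
      exact key i j (by simp [hi, hj])

end Graph

/-- Projective dimension of the edge ring of a multi-path graph with all
path lengths at least 2, having `m` paths of even length and `n` paths of odd length. -/
theorem statement3 (K : Type*) [Field K] (N : ℕ) (hN : 2 ≤ N) (ℓ : Fin N → ℕ)
    (hℓ : ∀ i, 2 ≤ ℓ i) (m n : ℕ)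
    (hm : m = Set.ncard {i : Fin N | Even (ℓ i)})
    (hn : n = Set.ncard {i : Fin N | Odd (ℓ i)}) :
    projDim (MvPolynomial (multiPath (fun i => ℓ i - 1)).edgeSet K)
        (ModuleCat.of _ (edgeRing K (multiPath (fun i => ℓ i - 1)))) =
      if 1 ≤ m ∧ 1 ≤ n then ((m + n - 2 : ℕ) : ℕ∞) else ((m + n - 1 : ℕ) : ℕ∞) := by
  have hc : ∀ i, 1 ≤ (fun i => ℓ i - 1) i := fun i => by have := hℓ i; simp only; omega
  haveI : Fintype (multiPath (fun i => ℓ i - 1)).edgeSet := Fintype.ofFinite _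
  have hpar : ∀ i, Even (ℓ i - 1) ↔ ¬ Even (ℓ i) := by
    intro i
    have h : ℓ i = (ℓ i - 1) + 1 := by have := hℓ i; omega
    conv_rhs => rw [h]
    rw [Nat.even_add_one, not_not]
  have hcm : (univ.filter (fun i => ¬ Even (ℓ i - 1))).card = m := by
    rw [hm, ← Set.ncard_coe_finset]
    congr 1
    ext i
    simp only [Finset.coe_filter, Finset.mem_univ, true_and, Set.mem_ofPred_eq]
    rw [hpar, not_not]
  have hcn : (univ.filter (fun i => Even (ℓ i - 1))).card = n := by
    rw [hn, ← Set.ncard_coe_finset]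
    congr 1
    ext i
    simp only [Finset.coe_filter, Finset.mem_univ, true_and, Set.mem_ofPred_eq]
    rw [hpar, Nat.not_even_iff_odd]
  have hσ : ∀ i b, ∃ e, pth hc e = i ∧ par hc e = b := by
    intro i b
    cases b
    · refine ⟨edgeEquiv hc ⟨i, ⟨1, by have := hc i; omega⟩⟩, pth_apply hc _, ?_⟩
      rw [par_apply]; simp
    · refine ⟨edgeEquiv hc ⟨i, 0⟩, pth_apply hc _, ?_⟩
      rw [par_apply]; simp
  have hmain := projDim_minor (K := K) (pth hc) (par hc) hσ
    (univ.filter (fun i => ¬ Even (ℓ i - 1))) (univ.filter (fun i => Even (ℓ i - 1)))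
    (Finset.disjoint_filter_filter_not _ _ _).symm
  rw [hcm, hcn] at hmain
  have hsum : m + n = N := by
    rw [← hcm, ← hcn, add_comm, Finset.card_filter_add_card_filter_not, Finset.card_univ, Fintype.card_fin]
  have ht := toric_eq (K := K) hc
  change projDim _ (ModuleCat.of (MvPolynomial (multiPath (fun i => ℓ i - 1)).edgeSet K)
    (MvPolynomial (multiPath (fun i => ℓ i - 1)).edgeSet K ⧸
      toricIdeal K (multiPath (fun i => ℓ i - 1)))) = _
  rw [ht]
  refine hmain.trans ?_
  split_ifs with h
  · congr 1; omega
  · congr 1; omega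

end Paper
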